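/- Let X be a compact set in C^n, z in X, and let mu in J_z(X) be a maximal Jensen measure, i.e., there is no nu in J_z(X) with nu different from mu such that nu(u) >= mu(u) for all u in PSH^c(X). Then supp mu is contained in B_X. -/

import Mathlib

open MeasureTheory Metric Filter Topology Set Complex
open scoped ENNReal

noncomputable section

/-- `ℂⁿ`. -/
abbrev En (n : ℕ) : Type := EuclideanSpace ℂ (Fin n)

instance (n : ℕ) : MeasurableSpace (En n) := borel _

instance (n : ℕ) : BorelSpace (En n) := ⟨rfl⟩

open Classical in
/-- The positive part of an extended real number, as an element of `ℝ≥0∞`. -/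
def epos (x : EReal) : ℝ≥0∞ := if x = ⊤ then ⊤ else ENNReal.ofReal x.toReal

/-- The integral of an `EReal`-valued function `u` against a measure `μ`, defined as the
difference of the lower integrals of the positive and negative parts of `u`. -/
def eint {α : Type*} [MeasurableSpace α] (μ : Measure α) (u : α → EReal) : EReal :=
  ((∫⁻ x, epos (u x) ∂μ : ℝ≥0∞) : EReal) - ((∫⁻ x, epos (-(u x)) ∂μ : ℝ≥0∞) : EReal)

/-- The normalized angular measure `(2π)⁻¹ dθ` on `[0, 2π)`. -/
def thetaM : Measure ℝ :=
  (ENNReal.ofReal ((2 * Real.pi)⁻¹)) • (volume.restrict (Set.Ico (0 : ℝ) (2 * Real.pi)))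

/-- A function `u` with values in `[-∞, ∞)` is plurisubharmonic on an open set `U ⊆ ℂⁿ`:
it is upper semicontinuous, `< ⊤`, and satisfies the sub-mean-value inequality on every
complex line. -/
def PshOnE {n : ℕ} (u : En n → EReal) (U : Set (En n)) : Prop :=
  UpperSemicontinuousOn u U ∧ (∀ z ∈ U, u z < ⊤) ∧
  ∀ z ∈ U, ∀ w : En n, ∀ r : ℝ, 0 < r →
    (∀ ζ : ℂ, ‖ζ‖ ≤ r → z + ζ • w ∈ U) →
    u z ≤ eint thetaM (fun θ => u (z + (circleMap 0 r θ) • w))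

/-- `μ` is a Jensen measure on `X` with barycenter `z`:  a Borel probability measure
supported on `X` such that `u z ≤ ∫ u dμ` for every function `u` continuous and
plurisubharmonic on some open neighborhood of `X`. -/
def IsJensen {n : ℕ} (X : Set (En n)) (z : En n) (μ : Measure (En n)) : Prop :=
  IsProbabilityMeasure μ ∧ μ Xᶜ = 0 ∧
  ∀ U : Set (En n), IsOpen U → X ⊆ U →
    ∀ u : En n → EReal, ContinuousOn u U → PshOnE u U → u z ≤ eint μ u

/-- `u : X → [-∞, ∞)` is plurisubharmonic on the compact set `X` : it is upper
semicontinuous on `X`, `< ⊤` on `X`, and satisfies the subaveraging inequality with respect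
to all Jensen measures on `X`. -/
def PSHe {n : ℕ} (X : Set (En n)) (u : En n → EReal) : Prop :=
  UpperSemicontinuousOn u X ∧ (∀ z ∈ X, u z < ⊤) ∧
  ∀ z ∈ X, ∀ μ : Measure (En n), IsJensen X z μ → u z ≤ eint μ u

/-- `PSH^c(X)`: continuous plurisubharmonic functions on `X`. -/
def PSHce {n : ℕ} (X : Set (En n)) (u : En n → EReal) : Prop :=
  PSHe X u ∧ ContinuousOn u X

/-- Real-valued continuous plurisubharmonic functions on `X`. -/
def PSHcR {n : ℕ} (X : Set (En n)) (u : En n → ℝ) : Prop :=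
  ContinuousOn u X ∧ PSHe X (fun x => (u x : EReal))

/-- `O_X`: the set of points `z ∈ X` whose only Jensen measure is `δ_z`. -/
def Oset {n : ℕ} (X : Set (En n)) : Set (En n) :=
  {z | z ∈ X ∧ ∀ μ : Measure (En n), IsJensen X z μ → μ = Measure.dirac z}

/-- The potential boundary `B_X`, the closure of `O_X`. -/
def Bset {n : ℕ} (X : Set (En n)) : Set (En n) := closure (Oset X)

/-- `J^b_z(X)`: Jensen measures with barycenter `z` supported on `B_X`. -/
def IsJensenB {n : ℕ} (X : Set (En n)) (z : En n) (μ : Measure (En n)) : Prop :=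
  IsJensen X z μ ∧ μ (Bset X)ᶜ = 0

/-- `ν` is subordinated to `μ` : `μ(u) ≥ ν(u)` for all `u ∈ PSH^c(X)`. -/
def Subord {n : ℕ} (X : Set (En n)) (μ ν : Measure (En n)) : Prop :=
  ∀ u : En n → EReal, PSHce X u → eint ν u ≤ eint μ u

/-- Subharmonic functions with values in `[-∞, ∞)` on an open set `U ⊆ ℂ`. -/
def SubharmOn (u : ℂ → EReal) (U : Set ℂ) : Prop :=
  UpperSemicontinuousOn u U ∧ (∀ z ∈ U, u z < ⊤) ∧
  ∀ z ∈ U, ∀ r : ℝ, 0 < r → closedBall z r ⊆ U →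
    u z ≤ eint thetaM (fun θ => u (circleMap z r θ))

/-- Harmonic (real-valued) functions on an open set `U ⊆ ℂ`: continuous functions
satisfying the mean-value equality. -/
def HarmOn (h : ℂ → ℝ) (U : Set ℂ) : Prop :=
  ContinuousOn h U ∧
  ∀ z ∈ U, ∀ r : ℝ, 0 < r → closedBall z r ⊆ U →
    h z = (2 * Real.pi)⁻¹ * ∫ θ in (0 : ℝ)..(2 * Real.pi), h (circleMap z r θ)

/-- Superharmonic (real-valued) functions on an open set `U ⊆ ℂ`. -/
def SuperharmOn (v : ℂ → ℝ) (U : Set ℂ) : Prop :=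
  LowerSemicontinuousOn v U ∧
  ∀ z ∈ U, ∀ r : ℝ, 0 < r → closedBall z r ⊆ U →
    (2 * Real.pi)⁻¹ * (∫ θ in (0 : ℝ)..(2 * Real.pi), v (circleMap z r θ)) ≤ v z

/-- The infimum of all positive superharmonic functions on the unit disk, extending
continuously to the closed disk and `≥ 1` on `A`, evaluated at `z`. -/
def hmPre (A : Set ℂ) (z : ℂ) : ℝ :=
  sInf {t : ℝ | ∃ v : ℂ → ℝ, SuperharmOn v (ball 0 1) ∧ (∀ w ∈ ball (0 : ℂ) 1, 0 < v w) ∧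
    ContinuousOn v (closedBall 0 1) ∧ (∀ w ∈ A, 1 ≤ v w) ∧ t = v z}

/-- The harmonic measure `ω(z, A, 𝔻)` of `A` with respect to the unit disk. -/
def hm (z : ℂ) (A : Set ℂ) : ℝ := Filter.liminf (fun w => hmPre A w) (𝓝 z)

open Classical in
/-- The radial limit of a map `f` at the boundary point `ζ` of the unit circle
(junk value `0` if the radial limit does not exist). -/
def bval {n : ℕ} (f : ℂ → En n) (ζ : ℂ) : En n :=
  if h : ∃ l : En n, Tendsto (fun r : ℝ => f ((r : ℂ) * ζ)) (𝓝[<] (1 : ℝ)) (𝓝 l)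
  then h.choose else 0

open Classical in
/-- The radial limit of an `EReal`-valued function on the disk at the boundary point `ζ`. -/
def bvalE (g : ℂ → EReal) (ζ : ℂ) : EReal :=
  if h : ∃ l : EReal, Tendsto (fun r : ℝ => g ((r : ℂ) * ζ)) (𝓝[<] (1 : ℝ)) (𝓝 l)
  then h.choose else 0

/-- `μ_f`: the push-forward of the normalized arclength measure on the unit circle under the
radial boundary values of `f`. -/
def bmeas {n : ℕ} (f : ℂ → En n) : Measure (En n) :=
  thetaM.map (fun θ => bval f (circleMap 0 1 θ))

/-- Weak-* convergence of a sequence of measures on `ℂⁿ`. -/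
def WeakConv {n : ℕ} (μs : ℕ → Measure (En n)) (μ : Measure (En n)) : Prop :=
  ∀ φ : BoundedContinuousFunction (En n) ℝ,
    Tendsto (fun j => ∫ x, φ x ∂(μs j)) atTop (𝓝 (∫ x, φ x ∂μ))

/-- The cluster set `cl L` of a sequence of maps of the unit disk into `ℂⁿ`. -/
def clusterSet {n : ℕ} (f : ℕ → ℂ → En n) : Set (En n) :=
  {z | ∀ r : ℝ, 0 < r → ∀ N : ℕ, ∃ j, N ≤ j ∧ ∃ ζ ∈ ball (0 : ℂ) 1, f j ζ ∈ ball z r}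

/-- A point `z` is totally essential for the sequence `f` if for every open set `V ∋ z` the
harmonic measures at `0` of `f j ⁻¹' V` stay bounded away from `0`. -/
def TotallyEssential {n : ℕ} (f : ℕ → ℂ → En n) (z : En n) : Prop :=
  ∀ V : Set (En n), IsOpen V → z ∈ V →
    0 < Filter.atTop.liminf (fun j => hm 0 ((f j ⁻¹' V) ∩ ball 0 1))

/-- A totally perfect sequence `L` of holomorphic maps of the unit disk into `ℂⁿ`: a
uniformly bounded sequence of holomorphic maps which is weak-* converging (with limit measure
`μ_L` and center `z_L`) and all of whose cluster points are totally essential. -/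
structure PerfectSeq (n : ℕ) where
  f : ℕ → ℂ → En n
  holo : ∀ j, DifferentiableOn ℂ (f j) (ball 0 1)
  bdd : ∃ C : ℝ, ∀ j, ∀ ζ ∈ ball (0 : ℂ) 1, ‖f j ζ‖ ≤ C
  μL : Measure (En n)
  conv : WeakConv (fun j => bmeas (f j)) μL
  zL : En n
  center : Tendsto (fun j => f j 0) atTop (𝓝 zL)
  ess : ∀ z ∈ clusterSet f, TotallyEssential f z

/-- `J_z^s(L)`: the measures obtained as weak-* limits of `μ_{f_{j_k} ∘ g_k}` for subsequences
`{j_k}` and holomorphic maps `g_k : 𝔻 → 𝔻` with `f_{j_k}(g_k(0)) → z`. -/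
def JsSet {n : ℕ} (L : PerfectSeq n) (z : En n) : Set (Measure (En n)) :=
  {μ | ∃ jk : ℕ → ℕ, StrictMono jk ∧ ∃ g : ℕ → ℂ → ℂ,
    (∀ k, DifferentiableOn ℂ (g k) (ball 0 1) ∧ MapsTo (g k) (ball 0 1) (ball 0 1)) ∧
    WeakConv (fun k => bmeas ((L.f (jk k)) ∘ (g k))) μ ∧
    Tendsto (fun k => L.f (jk k) (g k 0)) atTop (𝓝 z)}

/-- `J_z(L)`: the convex hull of `J_z^s(L)`. -/
def JLSet {n : ℕ} (L : PerfectSeq n) (z : En n) : Set (Measure (En n)) :=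
  {μ | ∃ (m : ℕ) (w : Fin m → ℝ) (ν : Fin m → Measure (En n)),
    (∀ i, 0 ≤ w i) ∧ (∑ i, w i = 1) ∧ (∀ i, ν i ∈ JsSet L z) ∧
    μ = ∑ i, (ENNReal.ofReal (w i)) • ν i}

/-- `u` is harmonic on the totally perfect sequence `L`. -/
def HarmonicOnL {n : ℕ} (L : PerfectSeq n) (u : En n → EReal) : Prop :=
  PSHce (clusterSet L.f) u ∧
  ∀ z ∈ clusterSet L.f, ∀ μ ∈ JLSet L z, eint μ u = u z

/-- `PSH^w(X)`: weakly plurisubharmonic functions, the upper envelopes of nonempty families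
of continuous plurisubharmonic functions on `X`. -/
def PSHw {n : ℕ} (X : Set (En n)) (u : En n → EReal) : Prop :=
  ∃ F : Set (En n → EReal), F.Nonempty ∧ (∀ v ∈ F, PSHce X v) ∧
    ∀ x ∈ X, u x = ⨆ v ∈ F, v x

/-- `u` is maximal on `X ∖ Z`: for every relatively open `V ⊆ X ∖ Z` and every
`v ∈ PSH^c(closure V)`, if `v ≤ u` on the relative boundary of `V` in `X` then `v ≤ u`
on `closure V`. -/
def MaximalOn {n : ℕ} (X Z : Set (En n)) (u : En n → EReal) : Prop :=
  ∀ W : Set (En n), IsOpen W → X ∩ W ⊆ X \ Z →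
    ∀ v : En n → EReal, PSHce (closure (X ∩ W)) v →
      (∀ x ∈ closure (X ∩ W) \ (X ∩ W), v x ≤ u x) →
      ∀ x ∈ closure (X ∩ W), v x ≤ u x

/-- Pluriharmonic continuous real-valued functions on `X`. -/
def Pluriharm {n : ℕ} (X : Set (En n)) (h : En n → ℝ) : Prop :=
  ContinuousOn h X ∧
  ∀ z ∈ X, ∀ μ : Measure (En n), IsJensen X z μ → (h z : EReal) = eint μ (fun x => (h x : EReal))

/-- `X` is a Poisson set: every continuous real-valued function on `B_X` extends to a
pluriharmonic function on `X`. -/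
def PoissonSet {n : ℕ} (X : Set (En n)) : Prop :=
  ∀ φ : En n → ℝ, ContinuousOn φ (Bset X) →
    ∃ h : En n → ℝ, Pluriharm X h ∧ ∀ w ∈ Bset X, h w = φ w

end

/-- A positive normalized linear functional on `C(K, ℝ)` is integration against a probability
measure. -/
lemma exists_isProbabilityMeasure_integral_eq {K : Type*} [TopologicalSpace K] [CompactSpace K]
    [T2Space K] [MeasurableSpace K] [BorelSpace K] (L : C(K, ℝ) →ₗ[ℝ] ℝ)
    (hpos : ∀ f, 0 ≤ f → 0 ≤ L f) (hone : L 1 = 1) :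
    ∃ ν : Measure K, IsProbabilityMeasure ν ∧ ∀ f : C(K, ℝ), ∫ x, f x ∂ν = L f := by
  let e : CompactlySupportedContinuousMap K ℝ →ₗ[ℝ] C(K, ℝ) :=
    { toFun := fun f => f.toContinuousMap
      map_add' := fun _ _ => rfl
      map_smul' := fun _ _ => rfl }
  let Λ : CompactlySupportedContinuousMap K ℝ →ₚ[ℝ] ℝ :=
    PositiveLinearMap.mk₀ (L ∘ₗ e) fun f hf => hpos _ hf
  have hΛ (f : C(K, ℝ)) : ∫ x, f x ∂(RealRMK.rieszMeasure Λ) = L f :=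
    RealRMK.integral_rieszMeasure Λ (CompactlySupportedContinuousMap.continuousMapEquiv f)
  refine ⟨RealRMK.rieszMeasure Λ, ?_, hΛ⟩
  have h := hΛ 1
  rw [hone] at h
  simp only [ContinuousMap.one_apply, integral_const, smul_eq_mul, mul_one] at h
  exact ⟨by rwa [measureReal_def, ENNReal.toReal_eq_one_iff] at h⟩

lemma integrable_continuousMap {K : Type*} [TopologicalSpace K] [CompactSpace K]
    [MeasurableSpace K] [BorelSpace K] (ν : Measure K) [IsProbabilityMeasure ν] (f : C(K, ℝ)) :
    Integrable (fun x => f x) ν := by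
  refine Integrable.of_bound f.continuous.aestronglyMeasurable ‖f‖ (ae_of_all _ fun x => ?_)
  exact f.norm_coe_le_norm x

/-- The upper envelope functional of `μ` with respect to a family `S` of continuous functions. -/
noncomputable def upperEnvelope {K : Type*} [TopologicalSpace K] [MeasurableSpace K] (S : Set C(K, ℝ))
    (μ : Measure K) (g : C(K, ℝ)) : ℝ :=
  sInf ((fun w : C(K, ℝ) => ∫ x, w x ∂μ) '' {w | w ∈ S ∧ g ≤ w})

/-- Given a convex cone `S` of continuous functions containing the constants, a probability
measure `μ` and a continuous function `f`, there is a probability measure `ν` lying below `μ` on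
`S` for which `∫ f dν` is the infimum of `∫ w dμ` over the majorants `w ∈ S` of `f`. -/
lemma exists_measure_le_on_cone {K : Type*} [TopologicalSpace K] [CompactSpace K]
    [T2Space K] [MeasurableSpace K] [BorelSpace K] (S : Set C(K, ℝ))
    (hconst : ∀ c : ℝ, ContinuousMap.const K c ∈ S)
    (hadd : ∀ v ∈ S, ∀ w ∈ S, v + w ∈ S) (hsmul : ∀ c : ℝ, 0 < c → ∀ w ∈ S, c • w ∈ S)
    (μ : Measure K) [IsProbabilityMeasure μ] (f : C(K, ℝ)) :
    ∃ ν : Measure K, IsProbabilityMeasure ν ∧ (∀ w ∈ S, ∫ x, w x ∂ν ≤ ∫ x, w x ∂μ) ∧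
      ∀ ε : ℝ, 0 < ε → ∃ w ∈ S, f ≤ w ∧ ∫ x, w x ∂μ < ∫ x, f x ∂ν + ε := by
  set q := upperEnvelope S μ
  have hmaj (g : C(K, ℝ)) : g ≤ ContinuousMap.const K ‖g‖ := fun x =>
    (le_abs_self _).trans (g.norm_coe_le_norm x)
  have hne (g : C(K, ℝ)) :
      ((fun w : C(K, ℝ) => ∫ x, w x ∂μ) '' {w | w ∈ S ∧ g ≤ w}).Nonempty :=
    ⟨_, _, ⟨hconst _, hmaj g⟩, rfl⟩
  have hlb (g : C(K, ℝ)) : ∫ x, g x ∂μ ∈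
      lowerBounds ((fun w : C(K, ℝ) => ∫ x, w x ∂μ) '' {w | w ∈ S ∧ g ≤ w}) := by
    rintro _ ⟨w, ⟨-, hw⟩, rfl⟩
    exact integral_mono (integrable_continuousMap μ g) (integrable_continuousMap μ w) hw
  have hq_le (g w : C(K, ℝ)) (hw : w ∈ S) (hgw : g ≤ w) : q g ≤ ∫ x, w x ∂μ :=
    csInf_le ⟨_, hlb g⟩ ⟨w, ⟨hw, hgw⟩, rfl⟩
  have hq_lt (g : C(K, ℝ)) (ε : ℝ) (hε : 0 < ε) :
      ∃ w ∈ S, g ≤ w ∧ ∫ x, w x ∂μ < q g + ε := by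
    obtain ⟨_, ⟨w, ⟨hw, hgw⟩, rfl⟩, hlt⟩ :=
      exists_lt_of_csInf_lt (hne g) (lt_add_of_pos_right (q g) hε)
    exact ⟨w, hw, hgw, hlt⟩
  have q_smul_le (c : ℝ) (hc : 0 < c) (g : C(K, ℝ)) : q (c • g) ≤ c * q g := by
    refine le_of_forall_pos_lt_add fun ε hε => ?_
    obtain ⟨w, hw, hgw, hlt⟩ := hq_lt g (ε / c) (by positivity)
    have h := hq_le (c • g) (c • w) (hsmul c hc w hw)
      (fun x => mul_le_mul_of_nonneg_left (hgw x) hc.le)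
    simp only [ContinuousMap.smul_apply, smul_eq_mul, integral_const_mul] at h
    calc q (c • g) ≤ c * ∫ x, w x ∂μ := h
      _ < c * (q g + ε / c) := by gcongr
      _ = c * q g + ε := by field_simp
  have q_smul (c : ℝ) (hc : 0 < c) (g : C(K, ℝ)) : q (c • g) = c * q g := by
    refine le_antisymm (q_smul_le c hc g) ?_
    have h := q_smul_le c⁻¹ (inv_pos.2 hc) (c • g)
    rw [smul_smul, inv_mul_cancel₀ hc.ne', one_smul] at h
    calc c * q g ≤ c * (c⁻¹ * q (c • g)) := by gcongr
      _ = q (c • g) := by field_simp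
  have q_add (g h : C(K, ℝ)) : q (g + h) ≤ q g + q h := by
    refine le_of_forall_pos_lt_add fun ε hε => ?_
    obtain ⟨v, hv, hgv, hv_lt⟩ := hq_lt g (ε / 2) (by positivity)
    obtain ⟨w, hw, hhw, hw_lt⟩ := hq_lt h (ε / 2) (by positivity)
    have hle := hq_le (g + h) (v + w) (hadd v hv w hw) (fun x => add_le_add (hgv x) (hhw x))
    simp only [ContinuousMap.add_apply] at hle
    rw [integral_add (integrable_continuousMap μ v) (integrable_continuousMap μ w)] at hle
    linarith
  have q_zero : q 0 = 0 := by
    have := q_smul 2 two_pos 0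
    rw [smul_zero] at this
    linarith
  have hker (c : ℝ) (hc : c • f = 0) : (RingHom.id ℝ) c • q f = 0 := by
    rcases smul_eq_zero.1 hc with h | h
    · simp [h]
    · simp [h, q_zero]
  obtain ⟨L, hLf, hLq⟩ := exists_extension_of_le_sublinear
    (LinearPMap.mkSpanSingleton' f (q f) hker) q q_smul q_add (by
      rintro ⟨x, hx⟩
      obtain ⟨c, rfl⟩ := Submodule.mem_span_singleton.1 hx
      rw [LinearPMap.mkSpanSingleton'_apply]
      simp only [RingHom.id_apply, smul_eq_mul]
      rcases lt_trichotomy c 0 with hc | rfl | hc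
      · have h1 := q_add (c • f) ((-c) • f)
        rw [q_smul (-c) (neg_pos.2 hc), ← add_smul, add_neg_cancel, zero_smul, q_zero] at h1
        linarith
      · simp [q_zero]
      · exact (q_smul c hc f).ge)
  have hLf' : L f = q f := by
    have := hLf ⟨f, Submodule.mem_span_singleton_self f⟩
    exact this.trans (LinearPMap.mkSpanSingleton'_apply_self f (q f) hker _)
  have hLS (w : C(K, ℝ)) (hw : w ∈ S) : L w ≤ ∫ x, w x ∂μ := (hLq w).trans (hq_le w w hw le_rfl)
  have hLpos (g : C(K, ℝ)) (hg : 0 ≤ g) : 0 ≤ L g := by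
    have h := (hLq (-g)).trans (hq_le (-g) (ContinuousMap.const K 0) (hconst 0)
      (fun x => neg_nonpos.2 (hg x)))
    simpa using h
  have hLone : L 1 = 1 := by
    have h1 := hLS _ (hconst 1)
    have h2 := hLS _ (hconst (-1))
    have e : ContinuousMap.const K (-1 : ℝ) = -1 := rfl
    have e' : ContinuousMap.const K (1 : ℝ) = 1 := rfl
    rw [e, map_neg] at h2
    rw [e'] at h1
    simp at h1 h2
    linarith
  obtain ⟨ν, hν, hνL⟩ := exists_isProbabilityMeasure_integral_eq L hLpos hLone
  refine ⟨ν, hν, fun w hw => (hνL w).trans_le (hLS w hw), fun ε hε => ?_⟩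
  rw [hνL, hLf']
  exact hq_lt f ε hε

lemma epos_eq_toENNReal (x : EReal) : epos x = x.toENNReal := rfl

lemma eint_mono {α : Type*} [MeasurableSpace α] (μ : Measure α) {u v : α → EReal} (h : u ≤ v) :
    eint μ u ≤ eint μ v := by
  refine EReal.sub_le_sub ?_ ?_
  · exact EReal.coe_ennreal_le_coe_ennreal_iff.2
      (lintegral_mono fun x => EReal.toENNReal_le_toENNReal (h x))
  · exact EReal.coe_ennreal_le_coe_ennreal_iff.2
      (lintegral_mono fun x => EReal.toENNReal_le_toENNReal (EReal.neg_le_neg_iff.2 (h x)))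

lemma eint_coe {α : Type*} [MeasurableSpace α] (μ : Measure α) {g : α → ℝ}
    (hg : Integrable g μ) : eint μ (fun x => (g x : EReal)) = ((∫ x, g x ∂μ : ℝ) : EReal) := by
  have hpos (x : α) : epos (g x : EReal) = ENNReal.ofReal (g x) := by
    simp [epos_eq_toENNReal]
  have hneg (x : α) : epos (-(g x : EReal)) = ENNReal.ofReal (-g x) := by
    rw [← EReal.coe_neg]
    simp [epos_eq_toENNReal]
  simp only [eint, hpos, hneg]
  rw [integral_eq_lintegral_pos_part_sub_lintegral_neg_part hg, EReal.coe_sub,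
    EReal.coe_ennreal_toReal, EReal.coe_ennreal_toReal]
  · exact hg.neg.lintegral_lt_top.ne
  · exact hg.lintegral_lt_top.ne

lemma eint_map {α β : Type*} [MeasurableSpace α] [MeasurableSpace β] {i : α → β}
    (hi : MeasurableEmbedding i) (μ : Measure α) (u : β → EReal) :
    eint (μ.map i) u = eint μ (u ∘ i) := by
  simp only [eint, hi.lintegral_map, Function.comp_apply]

/-- The truncation `max u (-k)` of an extended real valued function, as a real function. -/
noncomputable def truncBelow {α : Type*} (u : α → EReal) (k : ℕ) (x : α) : ℝ :=
  (max (u x) ((-(k : ℝ) : ℝ) : EReal)).toReal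

lemma coe_truncBelow {α : Type*} {u : α → EReal} {x : α} (hx : u x < ⊤) (k : ℕ) :
    (truncBelow u k x : EReal) = max (u x) ((-(k : ℝ) : ℝ) : EReal) :=
  EReal.coe_toReal (max_lt hx (EReal.coe_lt_top _)).ne
    ((EReal.bot_lt_coe _).trans_le (le_max_right _ _)).ne'

lemma continuous_truncBelow {α : Type*} [TopologicalSpace α] {u : α → EReal} (hu : Continuous u)
    (hlt : ∀ x, u x < ⊤) (k : ℕ) : Continuous (truncBelow u k) := by
  refine EReal.continuousOn_toReal.comp_continuous (hu.max continuous_const) fun x => ?_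
  simp only [mem_compl_iff, mem_insert_iff, mem_singleton_iff, not_or]
  exact ⟨((EReal.bot_lt_coe _).trans_le (le_max_right _ _)).ne',
    (max_lt (hlt x) (EReal.coe_lt_top _)).ne⟩

/-- A lower bound for the integrals of all truncations is a lower bound for the integral. -/
lemma le_eint_of_forall_le_eint_truncBelow {K : Type*} [TopologicalSpace K] [CompactSpace K]
    [MeasurableSpace K] [BorelSpace K] (μ : Measure K) [IsProbabilityMeasure μ] {u : K → EReal}
    (hu : Continuous u) (hlt : ∀ x, u x < ⊤) {c : EReal}
    (hc : ∀ k : ℕ, c ≤ eint μ (fun x => (truncBelow u k x : EReal))) : c ≤ eint μ u := by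
  have hpos (k : ℕ) (x : K) : epos (truncBelow u k x : EReal) = epos (u x) := by
    rw [coe_truncBelow (hlt x), epos_eq_toENNReal, epos_eq_toENNReal,
      (show Monotone EReal.toENNReal from fun _ _ => EReal.toENNReal_le_toENNReal).map_max,
      EReal.toENNReal_of_nonpos (x := ((-(k : ℝ) : ℝ) : EReal)) (by simp)]
    simp
  have hneg (k : ℕ) (x : K) :
      epos (-(truncBelow u k x : EReal)) = min (epos (-u x)) (k : ℝ≥0∞) := by
    rw [coe_truncBelow (hlt x), epos_eq_toENNReal, epos_eq_toENNReal, ← EReal.min_neg_neg,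
      (show Monotone EReal.toENNReal from fun _ _ => EReal.toENNReal_le_toENNReal).map_min,
      ← EReal.coe_neg, neg_neg, EReal.toENNReal_of_ne_top (EReal.coe_ne_top _), EReal.toReal_coe,
      ENNReal.ofReal_natCast]
  have hfin : ∫⁻ x, epos (u x) ∂μ ≠ ⊤ := by
    simp_rw [← hpos 0]
    have hint := integrable_continuousMap μ ⟨_, continuous_truncBelow hu hlt 0⟩
    simpa [epos_eq_toENNReal] using hint.lintegral_lt_top.ne
  have hmeas : Measurable fun x => epos (-u x) := by
    simp only [epos_eq_toENNReal]
    exact hu.measurable.neg.ereal_toENNReal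
  have hsup : ∫⁻ x, epos (-u x) ∂μ = ⨆ k : ℕ, ∫⁻ x, min (epos (-u x)) (k : ℝ≥0∞) ∂μ := by
    rw [← lintegral_iSup (fun k => hmeas.min measurable_const)
      (fun k l hkl x => min_le_min_left _ (Nat.cast_le.2 hkl))]
    refine lintegral_congr fun x => ?_
    rw [← inf_iSup_eq, ENNReal.iSup_natCast, inf_top_eq]
  have hmono : Monotone fun k : ℕ => ∫⁻ x, min (epos (-u x)) (k : ℝ≥0∞) ∂μ := fun k l hkl =>
    lintegral_mono fun x => min_le_min_left _ (Nat.cast_le.2 hkl)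
  have hlim := (continuous_coe_ennreal_ereal.tendsto _).comp (tendsto_atTop_iSup hmono)
  rw [← hsup] at hlim
  simp only [eint, hpos, hneg] at hc
  have hA : ((∫⁻ x, epos (u x) ∂μ : ℝ≥0∞) : EReal) ≠ ⊤ := by simpa using hfin
  have hA' : ((∫⁻ x, epos (u x) ∂μ : ℝ≥0∞) : EReal) ≠ ⊥ := by simp
  have hadd := (EReal.continuousAt_add (p := (_, -((∫⁻ x, epos (-u x) ∂μ : ℝ≥0∞) : EReal)))
    (.inl hA) (.inl hA')).tendsto.comp
      (tendsto_const_nhds.prodMk_nhds ((continuous_neg.tendsto _).comp hlim))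
  exact ge_of_tendsto' hadd hc

/-- The cone of continuous functions on `X` that are superaveraging with respect to all Jensen
measures. -/
def jensenSuperCone {n : ℕ} (X : Set (En n)) : Set C(X, ℝ) :=
  {w | ∀ (x : X) (ν : Measure (En n)), IsJensen X x ν →
    ∫ y, w y ∂(ν.comap ((↑) : X → En n)) ≤ w x}

section Jensen

variable {n : ℕ} {X : Set (En n)}

lemma IsJensen.map_comap (hX : MeasurableSet X) {x : En n} {ν : Measure (En n)}
    (hν : IsJensen X x ν) :
    (ν.comap ((↑) : X → En n)).map ((↑) : X → En n) = ν := by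
  rw [map_comap_subtype_coe hX]
  exact Measure.restrict_eq_self_of_ae_mem hν.2.1

lemma IsJensen.isProbabilityMeasure_comap (hX : MeasurableSet X) {x : En n}
    {ν : Measure (En n)} (hν : IsJensen X x ν) :
    IsProbabilityMeasure (ν.comap ((↑) : X → En n)) := by
  have := hν.1
  refine ⟨?_⟩
  have h := congrArg (fun m : Measure (En n) => m univ) (hν.map_comap hX)
  simpa [(MeasurableEmbedding.subtype_coe hX).map_apply] using h

lemma IsJensen.eint_comap (hX : MeasurableSet X) {x : En n} {ν : Measure (En n)}
    (hν : IsJensen X x ν) (u : En n → EReal) :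
    eint (ν.comap ((↑) : X → En n)) (u ∘ (↑)) = eint ν u := by
  rw [← eint_map (MeasurableEmbedding.subtype_coe hX), hν.map_comap hX]

lemma const_mem_jensenSuperCone (hX : MeasurableSet X) (c : ℝ) :
    ContinuousMap.const X c ∈ jensenSuperCone X := by
  intro x ν hν
  have := hν.isProbabilityMeasure_comap hX
  simp

lemma add_mem_jensenSuperCone (hX : IsCompact X) {v w : C(X, ℝ)}
    (hv : v ∈ jensenSuperCone X) (hw : w ∈ jensenSuperCone X) :
    v + w ∈ jensenSuperCone X := by
  intro x ν hν
  have := isCompact_iff_compactSpace.1 hX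
  have := hν.isProbabilityMeasure_comap hX.measurableSet
  simp only [ContinuousMap.add_apply]
  rw [integral_add (integrable_continuousMap _ v) (integrable_continuousMap _ w)]
  exact add_le_add (hv x ν hν) (hw x ν hν)

lemma smul_mem_jensenSuperCone {c : ℝ} (hc : 0 < c) {w : C(X, ℝ)}
    (hw : w ∈ jensenSuperCone X) : c • w ∈ jensenSuperCone X := by
  intro x ν hν
  simp only [ContinuousMap.smul_apply, smul_eq_mul, integral_const_mul]
  exact mul_le_mul_of_nonneg_left (hw x ν hν) hc.le

/-- Truncations of continuous plurisubharmonic functions are subaveraging with respect to all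
Jensen measures. -/
lemma PSHce.neg_truncBelow_mem (hX : IsCompact X) {u : En n → EReal} (hu : PSHce X u) (k : ℕ)
    (hcont : Continuous (truncBelow (u ∘ ((↑) : X → En n)) k)) :
    -(⟨_, hcont⟩ : C(X, ℝ)) ∈ jensenSuperCone X := by
  intro x ν hν
  have := isCompact_iff_compactSpace.1 hX
  have := hν.isProbabilityMeasure_comap hX.measurableSet
  have hlt (y : X) : (u ∘ ((↑) : X → En n)) y < ⊤ := hu.1.2.1 y y.2
  simp only [ContinuousMap.neg_apply, ContinuousMap.coe_mk, integral_neg, neg_le_neg_iff]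
  have hint : Integrable (truncBelow (u ∘ ((↑) : X → En n)) k)
      (ν.comap ((↑) : X → En n)) := integrable_continuousMap _ ⟨_, hcont⟩
  rw [← EReal.coe_le_coe_iff, ← eint_coe _ hint]
  rw [coe_truncBelow (hlt x)]
  refine max_le ?_ ?_
  · calc u x ≤ eint ν u := hu.1.2.2 x x.2 ν hν
      _ = eint (ν.comap ((↑) : X → En n)) (u ∘ (↑)) :=
        (hν.eint_comap hX.measurableSet u).symm
      _ ≤ _ := eint_mono _ fun y => by rw [coe_truncBelow (hlt y)]; exact le_max_left _ _
  · calc ((-(k : ℝ) : ℝ) : EReal)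
        = eint (ν.comap ((↑) : X → En n)) (fun _ => ((-(k : ℝ) : ℝ) : EReal)) := by
          rw [eint_coe _ (integrable_const _)]
          simp
      _ ≤ _ := eint_mono _ fun y => by rw [coe_truncBelow (hlt y)]; exact le_max_right _ _

lemma PSHce.eint_le_eint (hX : IsCompact X) {u : En n → EReal} (hu : PSHce X u)
    (κ ν : Measure X) [IsProbabilityMeasure κ] [IsProbabilityMeasure ν]
    (h : ∀ w ∈ jensenSuperCone X, ∫ x, w x ∂ν ≤ ∫ x, w x ∂κ) :
    eint κ (u ∘ (↑)) ≤ eint ν (u ∘ (↑)) := by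
  have := isCompact_iff_compactSpace.1 hX
  have hlt (y : X) : (u ∘ ((↑) : X → En n)) y < ⊤ := hu.1.2.1 y y.2
  have hcont : Continuous (u ∘ ((↑) : X → En n)) := continuousOn_iff_continuous_domRestrict.1 hu.2
  refine le_eint_of_forall_le_eint_truncBelow ν hcont hlt fun k => ?_
  have hk := continuous_truncBelow hcont hlt k
  have hle := h _ (hu.neg_truncBelow_mem hX k hk)
  simp only [ContinuousMap.neg_apply, ContinuousMap.coe_mk, integral_neg, neg_le_neg_iff] at hle
  calc eint κ (u ∘ (↑)) ≤ eint κ (fun x => (truncBelow (u ∘ ((↑) : X → En n)) k x : EReal)) :=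
        eint_mono _ fun y => by rw [coe_truncBelow (hlt y)]; exact le_max_left _ _
    _ = ((∫ x, truncBelow (u ∘ ((↑) : X → En n)) k x ∂κ : ℝ) : EReal) :=
        eint_coe _ (integrable_continuousMap _ ⟨_, hk⟩)
    _ ≤ ((∫ x, truncBelow (u ∘ ((↑) : X → En n)) k x ∂ν : ℝ) : EReal) :=
        EReal.coe_le_coe_iff.2 hle
    _ = _ := (eint_coe _ (integrable_continuousMap _ ⟨_, hk⟩)).symm

/-- The integral of a continuous function against a maximal Jensen measure is the infimum of the
integrals of its superaveraging majorants. -/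
lemma exists_majorant_of_maximal (hX : IsCompact X) {z : En n} {μ : Measure (En n)}
    (hμ : IsJensen X z μ)
    (hmax : ∀ ν : Measure (En n), IsJensen X z ν → Subord X ν μ → ν = μ)
    (f : C(X, ℝ)) {ε : ℝ} (hε : 0 < ε) :
    ∃ w ∈ jensenSuperCone X, f ≤ w ∧ ∫ x, w x ∂(μ.comap ((↑) : X → En n)) <
      ∫ x, f x ∂(μ.comap ((↑) : X → En n)) + ε := by
  have := isCompact_iff_compactSpace.1 hX
  have hemb := MeasurableEmbedding.subtype_coe hX.measurableSet
  have := hμ.isProbabilityMeasure_comap hX.measurableSet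
  obtain ⟨ν, hν, hle, happrox⟩ := exists_measure_le_on_cone (jensenSuperCone X)
    (const_mem_jensenSuperCone hX.measurableSet)
    (fun v hv w hw => add_mem_jensenSuperCone hX hv hw)
    (fun c hc w hw => smul_mem_jensenSuperCone hc hw) (μ.comap ((↑) : X → En n)) f
  have hsub : Subord X (ν.map ((↑) : X → En n)) μ := fun u hu => by
    rw [eint_map hemb, ← hμ.eint_comap hX.measurableSet]
    exact hu.eint_le_eint hX _ _ hle
  have hJ : IsJensen X z (ν.map ((↑) : X → En n)) := by
    refine ⟨Measure.isProbabilityMeasure_map hemb.measurable.aemeasurable, ?_, ?_⟩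
    · rw [hemb.map_apply]
      simp
    · intro U hU hXU u hu hpsh
      refine (hμ.2.2 U hU hXU u hu hpsh).trans (hsub u ⟨⟨?_, ?_, ?_⟩, hu.mono hXU⟩)
      · exact hpsh.1.mono hXU
      · exact fun x hx => hpsh.2.1 x (hXU hx)
      · exact fun x _ m hm => hm.2.2 U hU hXU u hu hpsh
  have heq : ν = μ.comap ((↑) : X → En n) := by
    rw [← hmax _ hJ hsub, hemb.comap_map]
  rw [← heq]
  rw [← heq] at happrox
  exact happrox ε hε

/-- With respect to a maximal Jensen measure, every continuous function is superaveraging at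
almost every point. -/
lemma ae_integral_le_of_maximal (hX : IsCompact X) {z : En n} {μ : Measure (En n)}
    (hμ : IsJensen X z μ)
    (hmax : ∀ ν : Measure (En n), IsJensen X z ν → Subord X ν μ → ν = μ) (f : C(X, ℝ)) :
    ∀ᵐ x : X ∂(μ.comap ((↑) : X → En n)), ∀ ν : Measure (En n), IsJensen X x ν →
      ∫ y, f y ∂(ν.comap ((↑) : X → En n)) ≤ f x := by
  have := isCompact_iff_compactSpace.1 hX
  have := hμ.isProbabilityMeasure_comap hX.measurableSet
  choose w hwS hfw hw using fun k : ℕ =>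
    exists_majorant_of_maximal hX hμ hmax f (Nat.one_div_pos_of_nat (α := ℝ) (n := k))
  have hlim : ∫⁻ x, ⨅ k, ENNReal.ofReal (w k x - f x) ∂(μ.comap ((↑) : X → En n)) = 0 := by
    refine le_antisymm (ge_of_tendsto' (x := atTop) (f := fun k : ℕ =>
      ENNReal.ofReal (1 / ((k : ℝ) + 1))) ?_ fun k => ?_) zero_le
    · simpa using ENNReal.tendsto_ofReal (tendsto_one_div_add_atTop_nhds_zero_nat (𝕜 := ℝ))
    · have hint := (integrable_continuousMap (μ.comap ((↑) : X → En n)) (w k)).sub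
        (integrable_continuousMap _ f)
      calc _ ≤ ∫⁻ x, ENNReal.ofReal (w k x - f x) ∂(μ.comap ((↑) : X → En n)) :=
            lintegral_mono fun x => iInf_le _ k
        _ = ENNReal.ofReal (∫ x, (w k x - f x) ∂(μ.comap ((↑) : X → En n))) :=
            (ofReal_integral_eq_lintegral_ofReal hint
              (ae_of_all _ fun x => sub_nonneg.2 (hfw k x))).symm
        _ ≤ _ := by
          refine ENNReal.ofReal_le_ofReal ?_
          rw [integral_sub (integrable_continuousMap _ _) (integrable_continuousMap _ _)]
          linarith [hw k]
  have hmeas : Measurable fun x => ⨅ k, ENNReal.ofReal (w k x - f x) :=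
    Measurable.iInf fun k => ((w k).continuous.sub f.continuous).measurable.ennreal_ofReal
  rw [lintegral_eq_zero_iff hmeas] at hlim
  filter_upwards [hlim] with x hx ν hν
  have := hν.isProbabilityMeasure_comap hX.measurableSet
  refine le_of_forall_pos_lt_add fun ε hε => ?_
  have hlt : ⨅ k, ENNReal.ofReal (w k x - f x) < ENNReal.ofReal ε := by
    rw [hx]
    simpa using hε
  obtain ⟨k, hk⟩ := iInf_lt_iff.1 hlt
  have hk' := (ENNReal.ofReal_lt_ofReal_iff hε).1 hk
  calc ∫ y, f y ∂(ν.comap ((↑) : X → En n)) ≤ ∫ y, w k y ∂(ν.comap ((↑) : X → En n)) :=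
        integral_mono (integrable_continuousMap _ _) (integrable_continuousMap _ _) (hfw k)
    _ ≤ w k x := hwS k x ν hν
    _ < f x + ε := by linarith

end Jensen

/-- A probability measure on a compact metric space whose average distance to each point `a` of a
dense set is at most the distance from `x` to `a` is concentrated at `x`. -/
lemma ae_eq_of_integral_dist_le {K : Type*} [MetricSpace K] [CompactSpace K] [MeasurableSpace K]
    [BorelSpace K] (ν : Measure K) [IsProbabilityMeasure ν] (x : K) {s : Set K} (hs : Dense s)
    (h : ∀ a ∈ s, ∫ y, dist y a ∂ν ≤ dist x a) : ∀ᵐ y ∂ν, y = x := by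
  have hint (a : K) : Integrable (fun y => dist y a) ν :=
    integrable_continuousMap ν ⟨fun y => dist y a, by fun_prop⟩
  have hle : ∫ y, dist y x ∂ν ≤ 0 := by
    refine le_of_forall_pos_le_add fun ε hε => ?_
    obtain ⟨a, ha, hxa⟩ := hs.exists_dist_lt x (half_pos hε)
    calc ∫ y, dist y x ∂ν ≤ ∫ y, (dist y a + dist x a) ∂ν :=
          integral_mono (hint x) ((hint a).add (integrable_const _))
            fun y => dist_triangle_right y x a
      _ = ∫ y, dist y a ∂ν + dist x a := by
          rw [integral_add (hint a) (integrable_const _)]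
          simp
      _ ≤ 0 + ε := by linarith [h a ha]
  have hzero := (integral_eq_zero_iff_of_nonneg (fun y => dist_nonneg) (hint x)).1
    (hle.antisymm (integral_nonneg fun y => dist_nonneg))
  filter_upwards [hzero] with y hy using dist_eq_zero.1 hy

/-- Corollary 3.4: a maximal Jensen measure is supported on `B_X`. -/
theorem stmt_5 {n : ℕ} (X : Set (En n)) (hX : IsCompact X) (z : En n) (hz : z ∈ X)
    (μ : Measure (En n)) (hμ : IsJensen X z μ)
    (hmax : ∀ ν : Measure (En n), IsJensen X z ν → Subord X ν μ → ν = μ) :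
    μ (Bset X)ᶜ = 0 := by
  have := isCompact_iff_compactSpace.1 hX
  have hemb := MeasurableEmbedding.subtype_coe hX.measurableSet
  have : Nonempty X := ⟨⟨z, hz⟩⟩
  have hae : ∀ᵐ x : X ∂(μ.comap ((↑) : X → En n)), (x : En n) ∈ Oset X := by
    have h := ae_all_iff.2 fun m : ℕ => ae_integral_le_of_maximal hX hμ hmax
      ⟨fun y => dist y (TopologicalSpace.denseSeq X m), by fun_prop⟩
    filter_upwards [h] with x hx
    refine ⟨x.2, fun ν hν => ?_⟩
    have := hν.isProbabilityMeasure_comap hX.measurableSet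
    have hνx := ae_eq_of_integral_dist_le (ν.comap ((↑) : X → En n)) x
      (TopologicalSpace.denseRange_denseSeq X) (by
        rintro _ ⟨m, rfl⟩
        exact hx m ν hν)
    rw [← hν.map_comap hX.measurableSet, Measure.map_congr (g := fun _ => (x : En n))
      (hνx.mono fun y hy => congrArg _ hy), Measure.map_const]
    simp
  rw [← hμ.map_comap hX.measurableSet, hemb.map_apply]
  exact measure_mono_null (fun x hx hO => hx (subset_closure hO)) hae
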